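/- Let V be a finite set with |V| ≥ 2 and H : 2^V → ℤ an integer-valued polymatroid rank function on V. Then the integer linear program min{ r(V) : r ∈ ℤ^V, r(X) ≥ H(V) − H(V∖X) for all proper subsets X ⊊ V } attains its minimum, and the minimum value R_NCO(V) equals ⌈R_ACO(V)⌉, where R_ACO(V) = max over partitions P of V with |P| ≥ 2 of Σ_{X∈P} (H(V) − H(X)) / (|P| − 1). -/

import Mathlib

open Finset

/-- `P` is a partition of `W`: nonempty pairwise disjoint blocks whose union is `W`. -/
def IsPartitionOf {V : Type*} [DecidableEq V] (W : Finset V) (P : Finset (Finset V)) : Prop :=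
  (∀ X ∈ P, X.Nonempty) ∧ (∀ X ∈ P, ∀ Y ∈ P, X ≠ Y → Disjoint X Y) ∧ P.biUnion id = W

/-- `H` is an integer-valued polymatroid rank function. -/
def IsPolymatroidZ {V : Type*} [Fintype V] [DecidableEq V] (H : Finset V → ℤ) : Prop :=
  H ∅ = 0 ∧ (∀ ⦃X Y : Finset V⦄, Y ⊆ X → H Y ≤ H X) ∧
    ∀ X Y : Finset V, H (X ∩ Y) + H (X ∪ Y) ≤ H X + H Y

/-- The quantity `Σ_{X ∈ P} (H(V) - H(X)) / (|P| - 1)` for integer-valued `H`. -/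
noncomputable def partitionRateZ {V : Type*} [Fintype V] (H : Finset V → ℤ)
    (P : Finset (Finset V)) : ℝ :=
  ∑ X ∈ P, ((H Finset.univ : ℝ) - (H X : ℝ)) / ((P.card : ℝ) - 1)

theorem IsPartitionOf.sum_sum {V M : Type*} [DecidableEq V] [AddCommMonoid M] {W : Finset V}
    {P : Finset (Finset V)} (hP : IsPartitionOf W P) (r : V → M) :
    ∑ X ∈ P, ∑ i ∈ X, r i = ∑ i ∈ W, r i := by
  rw [← hP.2.2, Finset.sum_biUnion]
  · rfl
  · intro X hX Y hY hXY
    exact hP.2.1 X hX Y hY hXY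

theorem partitionRateZ_le_iff {V : Type*} [Fintype V] (H : Finset V → ℤ)
    {P : Finset (Finset V)} (hP : 2 ≤ P.card) (a : ℤ) :
    partitionRateZ H P ≤ a ↔ a ≤ ∑ X ∈ P, (H X + a - H Finset.univ) := by
  have hpos : (0 : ℝ) < (P.card : ℝ) - 1 := by
    have : (2 : ℝ) ≤ P.card := by exact_mod_cast hP
    linarith
  rw [partitionRateZ, ← Finset.sum_div, div_le_iff₀ hpos, ← Int.cast_le (R := ℝ)]
  push_cast
  simp only [Finset.sum_sub_distrib, Finset.sum_add_distrib, Finset.sum_const, nsmul_eq_mul]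
  constructor <;> intro h <;> linarith

/-- An integer vector of maximal sum below an intersecting submodular function `f` attains the
sum of `f` over some partition into nonempty sets. -/
theorem exists_le_sum_eq_partition_sum {V : Type*} [Fintype V] [DecidableEq V]
    (f : Finset V → ℤ)
    (hf : ∀ X Y : Finset V, (X ∩ Y).Nonempty → f (X ∩ Y) + f (X ∪ Y) ≤ f X + f Y)
    (hV : (Finset.univ : Finset V).Nonempty) :
    ∃ r : V → ℤ, (∀ Y : Finset V, Y.Nonempty → ∑ i ∈ Y, r i ≤ f Y) ∧
      ∃ P : Finset (Finset V), IsPartitionOf Finset.univ P ∧ ∑ i, r i = ∑ X ∈ P, f X := by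
  obtain ⟨s, ⟨r, hr, hrs⟩, hmax⟩ := Int.exists_greatest_of_bdd
    (P := fun s => ∃ r : V → ℤ, (∀ Y : Finset V, Y.Nonempty → ∑ i ∈ Y, r i ≤ f Y) ∧ ∑ i, r i = s)
    ⟨f Finset.univ, by
      rintro s ⟨r, hr, rfl⟩
      exact hr _ hV⟩
    (by
      refine ⟨_, fun _ => -∑ Z : Finset V, |f Z|, fun Y hY => ?_, rfl⟩
      have h1 : |f Y| ≤ ∑ Z : Finset V, |f Z| :=
        Finset.single_le_sum (f := fun Z => |f Z|) (fun Z _ => abs_nonneg _) (Finset.mem_univ Y)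
      have h2 : (1 : ℤ) ≤ Y.card := by exact_mod_cast hY.card_pos
      have h3 := neg_abs_le (f Y)
      have h4 := abs_nonneg (f Y)
      rw [Finset.sum_const, nsmul_eq_mul]
      nlinarith)
  have htight : ∀ v : V, ∃ Y : Finset V, v ∈ Y ∧ ∑ i ∈ Y, r i = f Y := by
    intro v
    by_contra! hv
    have := hmax (s + 1) ⟨fun i => r i + if i = v then 1 else 0, fun Y hY => ?_, ?_⟩
    · omega
    · rw [Finset.sum_add_distrib, Finset.sum_ite_eq']
      have := hr Y hY
      split_ifs with h
      · have := hv Y h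
        omega
      · omega
    · rw [Finset.sum_add_distrib, hrs]
      simp
  have hT : ∀ v : V, ∃ Y : Finset V, (v ∈ Y ∧ ∑ i ∈ Y, r i = f Y) ∧
      ∀ Z : Finset V, v ∈ Z → ∑ i ∈ Z, r i = f Z → Z.card ≤ Y.card := by
    intro v
    obtain ⟨Y, hY⟩ := htight v
    obtain ⟨Y, hY, hYmax⟩ := Finset.exists_max_image
      (Finset.univ.filter fun Y : Finset V => v ∈ Y ∧ ∑ i ∈ Y, r i = f Y) Finset.card
      ⟨Y, by simpa using hY⟩
    exact ⟨Y, by simpa using hY, fun Z h1 h2 => hYmax Z (by simp [h1, h2])⟩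
  choose T hT hTmax using hT
  have hsub : ∀ u v : V, (T u ∩ T v).Nonempty → T v ⊆ T u := by
    intro u v huv
    have hunion : ∑ i ∈ T u ∪ T v, r i = f (T u ∪ T v) := by
      have h1 := hf _ _ huv
      have h2 := hr _ huv
      have h3 := hr (T u ∪ T v) ⟨u, Finset.mem_union_left _ (hT u).1⟩
      have h4 := Finset.sum_union_inter (s₁ := T u) (s₂ := T v) (f := r)
      have h5 := (hT u).2
      have h6 := (hT v).2
      omega
    have hcard := hTmax u _ (Finset.mem_union_left _ (hT u).1) hunion
    rw [Finset.eq_of_subset_of_card_le Finset.subset_union_left hcard]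
    exact Finset.subset_union_right
  have hP : IsPartitionOf Finset.univ (Finset.univ.image T) := by
    refine ⟨?_, ?_, ?_⟩
    · simp only [Finset.mem_image, Finset.mem_univ, true_and]
      rintro _ ⟨v, rfl⟩
      exact ⟨v, (hT v).1⟩
    · simp only [Finset.mem_image, Finset.mem_univ, true_and]
      rintro _ ⟨u, rfl⟩ _ ⟨v, rfl⟩ huv
      by_contra hdisj
      rw [Finset.disjoint_iff_inter_eq_empty, ← Ne, ← Finset.nonempty_iff_ne_empty] at hdisj
      exact huv ((hsub v u (by rwa [Finset.inter_comm])).antisymm (hsub u v hdisj))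
    · ext v
      simp only [Finset.mem_biUnion, Finset.mem_image, Finset.mem_univ, true_and, iff_true]
      exact ⟨T v, ⟨v, rfl⟩, (hT v).1⟩
  refine ⟨r, hr, _, hP, ?_⟩
  rw [← hP.sum_sum]
  refine Finset.sum_congr rfl fun X hX => ?_
  obtain ⟨v, -, rfl⟩ := Finset.mem_image.1 hX
  exact (hT v).2

/-- the ILP `min{ r(V) : r ∈ ℤ^V, r ∈ R_CO(V) }` attains its minimum and
its value `R_NCO(V)` equals `⌈R_ACO(V)⌉`. -/
theorem nonasymptotic_min_sum_rate {V : Type*} [Fintype V] [DecidableEq V]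
    (H : Finset V → ℤ) (hV : 2 ≤ Fintype.card V) (hH : IsPolymatroidZ H)
    (γ : ℝ)
    (hγ : IsGreatest {t : ℝ | ∃ P : Finset (Finset V),
      IsPartitionOf Finset.univ P ∧ 2 ≤ P.card ∧ t = partitionRateZ H P} γ) :
    IsLeast {s : ℤ | ∃ r : V → ℤ,
      (∀ X : Finset V, X ⊂ Finset.univ →
        H Finset.univ - H (Finset.univ \ X) ≤ ∑ i ∈ X, r i) ∧
      ∑ i, r i = s} ⌈γ⌉ := by
  have huniv : (Finset.univ : Finset V).Nonempty := by
    rw [← Finset.card_pos, Finset.card_univ]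
    omega
  constructor
  · obtain ⟨r, hr, P, hP, hrP⟩ := exists_le_sum_eq_partition_sum
      (fun Y => H Y + ⌈γ⌉ - H Finset.univ)
      (fun X Y _ => by
        have := hH.2.2 X Y
        omega) huniv
    have hsum : ⌈γ⌉ ≤ ∑ X ∈ P, (H X + ⌈γ⌉ - H Finset.univ) := by
      by_cases hcard : 2 ≤ P.card
      · rw [← partitionRateZ_le_iff H hcard]
        exact (hγ.2 ⟨P, hP, hcard, rfl⟩).trans (Int.le_ceil γ)
      · have hne : P.Nonempty := by
          rw [Finset.nonempty_iff_ne_empty]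
          rintro rfl
          exact huniv.ne_empty hP.2.2.symm
        obtain ⟨X, rfl⟩ := Finset.card_eq_one.1
          (show P.card = 1 by have := hne.card_pos; omega)
        have hX : X = Finset.univ := by simpa using hP.2.2
        simp [hX]
    have hle := hr Finset.univ huniv
    refine ⟨r, fun X hX => ?_, by omega⟩
    have hY := hr (Finset.univ \ X) (Finset.sdiff_nonempty.2 hX.2)
    have := Finset.sum_sdiff (f := r) (Finset.subset_univ X)
    omega
  · rintro s ⟨r, hr, rfl⟩
    obtain ⟨P, hP, hcard, rfl⟩ := hγ.1
    rw [Int.ceil_le, partitionRateZ_le_iff H hcard]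
    conv_lhs => rw [← hP.sum_sum]
    refine Finset.sum_le_sum fun X hX => ?_
    have hssub : Finset.univ \ X ⊂ Finset.univ :=
      Finset.sdiff_ssubset (Finset.subset_univ X) (hP.1 X hX)
    have h1 := hr _ hssub
    rw [Finset.sdiff_sdiff_eq_self (Finset.subset_univ X)] at h1
    have := Finset.sum_sdiff (f := r) (Finset.subset_univ X)
    omega
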